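/- arXiv:2109.01029 — 4 statements merged into one kernel-verified Lean document; each statement's English description precedes it below -/
import Mathlib

section
/- Let g ∈ L¹(ℝ³;ℂ) be radial, i.e. there is a function G : [0,∞) → ℂ with g(ξ) = G(‖ξ‖) for all ξ ∈ ℝ³. Then for every real t ≠ 0 one has ∫_{ℝ³} e^{i t ξ₃/‖ξ‖} g(ξ) dξ = (sin t / t) · ∫_{ℝ³} g(ξ) dξ. -/
open MeasureTheory

noncomputable def enorm3 (ξ : Fin 3 → ℝ) : ℝ := Real.sqrt (ξ 0 ^ 2 + ξ 1 ^ 2 + ξ 2 ^ 2)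

open Set Metric in
/-- Integration in polar coordinates of a product of an angular and a radial factor. -/
lemma integral_angular_mul_radial {E 𝕜 : Type*} [NormedAddCommGroup E] [NormedSpace ℝ E]
    [MeasurableSpace E] [Nontrivial E] [FiniteDimensional ℝ E] [BorelSpace E] [RCLike 𝕜]
    (μ : Measure E) [μ.IsAddHaarMeasure] (Φ : E → 𝕜) (h : ℝ → 𝕜) :
    ∫ x, Φ (‖x‖⁻¹ • x) * h ‖x‖ ∂μ = (∫ ω : sphere (0 : E) 1, Φ ω ∂μ.toSphere) *
      ∫ r in Ioi (0 : ℝ), (r ^ (Module.finrank ℝ E - 1)) • h r :=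
  calc
    ∫ x, Φ (‖x‖⁻¹ • x) * h ‖x‖ ∂μ
        = ∫ x : ({(0)}ᶜ : Set E), Φ (‖x.1‖⁻¹ • x.1) * h ‖x.1‖ ∂(μ.comap (↑)) := by
      rw [integral_subtype_comap (measurableSet_singleton _).compl
        fun x ↦ Φ (‖x‖⁻¹ • x) * h ‖x‖, restrict_compl_singleton]
    _ = ∫ x, Φ x.1 * h x.2 ∂μ.toSphere.prod (.volumeIoiPow (Module.finrank ℝ E - 1)) := by
      simpa using μ.measurePreserving_homeomorphUnitSphereProd.integral_comp
        (Homeomorph.measurableEmbedding _)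
        (fun x : sphere (0 : E) 1 × Ioi (0 : ℝ) ↦ Φ x.1 * h x.2)
    _ = (∫ ω : sphere (0 : E) 1, Φ ω ∂μ.toSphere) *
        ∫ x : Ioi (0 : ℝ), h x ∂.volumeIoiPow (Module.finrank ℝ E - 1) :=
      integral_prod_mul (fun ω : sphere (0 : E) 1 ↦ Φ ω) (fun x : Ioi (0 : ℝ) ↦ h x)
    _ = _ := by
      simp only [Measure.volumeIoiPow, ENNReal.ofReal]
      rw [integral_withDensity_eq_integral_smul, integral_subtype_comap measurableSet_Ioi
          fun a ↦ Real.toNNReal (a ^ (Module.finrank ℝ E - 1)) • h a,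
        setIntegral_congr_fun measurableSet_Ioi fun x hx ↦ ?_]
      · rw [NNReal.smul_def, Real.coe_toNNReal _ (pow_nonneg hx.out.le _)]
      · exact (measurable_subtype_coe.pow_const _).real_toNNReal

open Set in
lemma integral_Ioi_pow_mul_exp_neg_sq (n : ℕ) :
    ∫ x in Ioi (0 : ℝ), x ^ n * Real.exp (-x ^ 2) = 1 / 2 * Real.Gamma ((n + 1) / 2) := by
  have := integral_rpow_mul_exp_neg_rpow (p := 2) (q := n) two_pos
    (by have := n.cast_nonneg (α := ℝ); linarith)
  simpa only [Real.rpow_natCast, Real.rpow_two] using this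

open Set in
lemma integral_pow_mul_exp_neg_sq (n : ℕ) :
    ∫ x : ℝ, x ^ n * Real.exp (-x ^ 2) =
      (1 + (-1) ^ n) * ∫ x in Ioi (0 : ℝ), x ^ n * Real.exp (-x ^ 2) := by
  have hint : Integrable fun x : ℝ ↦ x ^ n * Real.exp (-x ^ 2) := by
    simpa using integrable_rpow_mul_exp_neg_mul_sq (b := 1) one_pos (s := n)
      (by have := n.cast_nonneg (α := ℝ); linarith)
  have hneg := integral_comp_neg_Ioi (0 : ℝ) fun x : ℝ ↦ x ^ n * Real.exp (-x ^ 2)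
  rw [neg_zero] at hneg
  rw [← intervalIntegral.integral_Iic_add_Ioi hint.integrableOn hint.integrableOn (b := 0),
    ← hneg, add_mul, one_mul, add_comm, ← integral_const_mul]
  congr 2 with x
  rw [neg_pow x, neg_sq]
  ring

lemma integral_euclideanSpace_pow_mul_exp_neg_norm_sq (n : ℕ) :
    ∫ x : EuclideanSpace ℝ (Fin 3), x 2 ^ n * Real.exp (-‖x‖ ^ 2) =
      Real.pi * ∫ x : ℝ, x ^ n * Real.exp (-x ^ 2) := by
  have hgauss : ∫ x : ℝ, Real.exp (-x ^ 2) = √Real.pi := by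
    simpa using integral_gaussian 1
  rw [← (PiLp.volume_preserving_toLp (Fin 3)).integral_comp
    (MeasurableEquiv.toLp 2 _).measurableEmbedding]
  have := integral_fintype_prod_volume_eq_prod (𝕜 := ℝ)
    (![fun x : ℝ ↦ Real.exp (-x ^ 2), fun x ↦ Real.exp (-x ^ 2),
      fun x ↦ x ^ n * Real.exp (-x ^ 2)])
  simp only [Fin.prod_univ_three, Matrix.cons_val] at this
  rw [hgauss, Real.mul_self_sqrt Real.pi_pos.le] at this
  rw [← this]
  congr 1 with x
  rw [EuclideanSpace.norm_sq_eq, Fin.sum_univ_three]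
  simp only [Real.norm_eq_abs, sq_abs, neg_add, Real.exp_add]
  ring

open Metric in
/-- The moments of a coordinate on the unit sphere of `ℝ³` are those of the uniform measure of
total mass `4π` on `[-1, 1]` (the hat-box theorem of Archimedes). -/
lemma integral_sphere_coord_pow (n : ℕ) :
    ∫ ω : sphere (0 : EuclideanSpace ℝ (Fin 3)) 1, ω.1 2 ^ n ∂(volume.toSphere) =
      2 * Real.pi * ∫ s in (-1 : ℝ)..1, s ^ n := by
  have hpolar := integral_angular_mul_radial (𝕜 := ℝ)
    (volume : Measure (EuclideanSpace ℝ (Fin 3))) (fun x ↦ x 2 ^ n)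
    (fun r ↦ r ^ n * Real.exp (-r ^ 2))
  have hl : ∀ x : EuclideanSpace ℝ (Fin 3),
      (‖x‖⁻¹ • x) 2 ^ n * (‖x‖ ^ n * Real.exp (-‖x‖ ^ 2)) = x 2 ^ n * Real.exp (-‖x‖ ^ 2) := by
    intro x
    rcases eq_or_ne x 0 with rfl | hx
    · cases n <;> simp
    · have : ‖x‖ ≠ 0 := norm_ne_zero_iff.2 hx
      rw [← mul_assoc, ← mul_pow]
      congr 2
      simp only [PiLp.smul_apply, smul_eq_mul]
      field_simp
  have hr : ∀ r : ℝ, (r ^ (Module.finrank ℝ (EuclideanSpace ℝ (Fin 3)) - 1)) •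
      (r ^ n * Real.exp (-r ^ 2)) = r ^ (n + 2) * Real.exp (-r ^ 2) := by
    intro r
    simp only [finrank_euclideanSpace_fin, smul_eq_mul]
    ring
  have hn : (0 : ℝ) < (n + 1) / 2 := by positivity
  have hG := Real.Gamma_pos_of_pos hn
  simp only [hl, hr] at hpolar
  rw [integral_euclideanSpace_pow_mul_exp_neg_norm_sq, integral_pow_mul_exp_neg_sq,
    integral_Ioi_pow_mul_exp_neg_sq, integral_Ioi_pow_mul_exp_neg_sq,
    show ((n + 2 : ℕ) + 1 : ℝ) / 2 = (n + 1) / 2 + 1 by push_cast; ring,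
    Real.Gamma_add_one hn.ne'] at hpolar
  rw [integral_pow]
  field_simp at hpolar ⊢
  rw [pow_succ (-1 : ℝ)]
  linear_combination -hpolar

/-- Expansion of a characteristic function in terms of the moments. -/
lemma hasSum_moments_integral_cexp {α : Type*} [MeasurableSpace α] (μ : Measure α)
    [IsFiniteMeasure μ] {f : α → ℝ} (hf : AEMeasurable f μ) (hf1 : ∀ᵐ x ∂μ, |f x| ≤ 1) (c : ℂ) :
    HasSum (fun n : ℕ ↦ c ^ n / n.factorial * ((∫ x, f x ^ n ∂μ : ℝ) : ℂ))
      (∫ x, Complex.exp (c * f x) ∂μ) := by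
  have key := hasSum_integral_of_dominated_convergence (μ := μ)
    (F := fun (n : ℕ) x ↦ c ^ n / n.factorial * ((f x ^ n : ℝ) : ℂ))
    (f := fun x ↦ Complex.exp (c * f x)) (fun n _ ↦ ‖c‖ ^ n / n.factorial)
    (fun n ↦ by
      have : AEMeasurable (fun x ↦ c ^ n / n.factorial * ((f x ^ n : ℝ) : ℂ)) μ := by fun_prop
      exact this.aestronglyMeasurable)
    (fun n ↦ by
      filter_upwards [hf1] with x hx
      rw [norm_mul, norm_div, norm_pow, Complex.norm_natCast, Complex.norm_real, norm_pow,
        Real.norm_eq_abs]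
      exact mul_le_of_le_one_right (by positivity) (pow_le_one₀ (abs_nonneg _) hx))
    (.of_forall fun _ ↦ Real.summable_pow_div_factorial _)
    (integrable_const _)
    (.of_forall fun x ↦ by
      have := NormedSpace.expSeries_div_hasSum_exp (c * f x : ℂ)
      rw [← Complex.exp_eq_exp_ℂ] at this
      simpa only [mul_pow, mul_div_right_comm, Complex.ofReal_pow] using this)
  simpa only [integral_const_mul, integral_complex_ofReal] using key

open Metric in
lemma integral_sphere_cexp_coord {t : ℝ} (ht : t ≠ 0) :
    ∫ ω : sphere (0 : EuclideanSpace ℝ (Fin 3)) 1,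
      Complex.exp (Complex.I * t * (ω.1 2 : ℝ)) ∂(volume.toSphere) =
      4 * Real.pi * ((Real.sin t / t : ℝ) : ℂ) := by
  have hsphere := hasSum_moments_integral_cexp
    (volume : Measure (EuclideanSpace ℝ (Fin 3))).toSphere
    (f := fun ω ↦ ω.1 2) (by fun_prop)
    (.of_forall fun ω ↦ by
      simpa [norm_eq_of_mem_sphere ω] using PiLp.norm_apply_le ω.1 2) (Complex.I * t)
  have hinterval := (hasSum_moments_integral_cexp
    (volume.restrict (Set.Ioc (-1 : ℝ) 1)) (f := fun s ↦ s) (by fun_prop)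
    (by
      filter_upwards [ae_restrict_mem measurableSet_Ioc] with s hs
      exact abs_le.2 ⟨hs.1.le, hs.2⟩) (Complex.I * t)).mul_left (2 * Real.pi : ℂ)
  simp only [← intervalIntegral.integral_of_le (show (-1 : ℝ) ≤ 1 by norm_num)] at hinterval
  have hc : Complex.I * t ≠ 0 := by simp [ht]
  have ht' : (t : ℂ) ≠ 0 := by exact_mod_cast ht
  simp only [integral_sphere_coord_pow, Complex.ofReal_mul, Complex.ofReal_ofNat] at hsphere
  simp only [mul_left_comm (2 * Real.pi : ℂ)] at hinterval
  rw [hsphere.unique hinterval, integral_exp_mul_complex hc]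
  push_cast
  rw [Complex.sin, mul_one, mul_neg_one, mul_comm Complex.I (t : ℂ), neg_mul]
  field_simp
  rw [Complex.I_sq]
  ring

lemma enorm3_eq_norm_toLp (ξ : Fin 3 → ℝ) : enorm3 ξ = ‖WithLp.toLp 2 ξ‖ := by
  simp [enorm3, EuclideanSpace.norm_eq, Fin.sum_univ_three]

/-- If `g ∈ L¹(ℝ³;ℂ)` is radial, then for every `t ≠ 0`,
`∫ e^{i t ξ₃/‖ξ‖} g(ξ) dξ = (sin t / t) ∫ g(ξ) dξ`. -/
theorem stmt0 (g : (Fin 3 → ℝ) → ℂ) (hg : Integrable g)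
    (G : ℝ → ℂ) (hrad : ∀ ξ : Fin 3 → ℝ, g ξ = G (enorm3 ξ))
    (t : ℝ) (ht : t ≠ 0) :
    (∫ ξ : Fin 3 → ℝ, Complex.exp (Complex.I * (t : ℂ) * ((ξ 2 / enorm3 ξ : ℝ) : ℂ)) * g ξ) =
      ((Real.sin t / t : ℝ) : ℂ) * ∫ ξ : Fin 3 → ℝ, g ξ := by
  have htransfer := fun F : EuclideanSpace ℝ (Fin 3) → ℂ ↦
    (PiLp.volume_preserving_toLp (Fin 3)).integral_comp
      (MeasurableEquiv.toLp 2 _).measurableEmbedding F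
  have hleft := (htransfer _).trans (integral_angular_mul_radial volume
    (fun x ↦ Complex.exp (Complex.I * t * ((x 2 : ℝ) : ℂ))) G)
  have hright := (htransfer _).trans (integral_angular_mul_radial volume (fun _ ↦ 1) G)
  have hmass : (volume : Measure (EuclideanSpace ℝ (Fin 3))).toSphere.real Set.univ =
      4 * Real.pi := by
    have := integral_sphere_coord_pow 0
    simp only [pow_zero, integral_const, intervalIntegral.integral_const, smul_eq_mul,
      mul_one] at this
    rw [this]
    ring
  rw [integral_sphere_cexp_coord ht] at hleft
  simp only [one_mul, integral_const, hmass] at hright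
  simp only [PiLp.smul_apply, smul_eq_mul, inv_mul_eq_div] at hleft
  simp only [hrad, enorm3_eq_norm_toLp]
  rw [hright, hleft, Complex.real_smul]
  push_cast
  ring
end

section
/- Let ξ, η ∈ ℝ³ with ξ ≠ 0, η ≠ 0 and ξ − η ≠ 0. Then S_η Φ(ξ,η) = σ̄(ξ,η) · (ξ_h − η_h) / ‖ξ−η‖³, i.e. the derivative of Φ along the scaling vector field in η equals the dot product (in ℝ²) of σ̄(ξ,η) with ξ_h − η_h, divided by ‖ξ−η‖³. -/
/-- Euclidean norm on `ℝ³`. -/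
noncomputable def nrm (ξ : Fin 3 → ℝ) : ℝ := Real.sqrt (ξ 0 ^ 2 + ξ 1 ^ 2 + ξ 2 ^ 2)

/-- The dispersion relation `Λ(ξ) = ξ₃ / ‖ξ‖`. -/
noncomputable def Lam (ξ : Fin 3 → ℝ) : ℝ := ξ 2 / nrm ξ

/-- The phase `Φ(ξ,η) = Λ(ξ) + Λ(ξ−η) + ν Λ(η)`. -/
noncomputable def Phi (ν : ℝ) (ξ η : Fin 3 → ℝ) : ℝ := Lam ξ + Lam (ξ - η) + ν * Lam η

/-- Scaling vector field `S_η f = η · ∇_η f`. -/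
noncomputable def SV (f : (Fin 3 → ℝ) → ℝ) : (Fin 3 → ℝ) → ℝ := fun η => fderiv ℝ f η η

/-- Rotation vector field `Ω_η f = −η₂ ∂_{η₁} f + η₁ ∂_{η₂} f`. -/
noncomputable def OV (f : (Fin 3 → ℝ) → ℝ) : (Fin 3 → ℝ) → ℝ :=
  fun η => fderiv ℝ f η ![-(η 1), η 0, 0]

lemma sum_sq_pos {ζ : Fin 3 → ℝ} (h : ζ ≠ 0) : 0 < ζ 0 ^ 2 + ζ 1 ^ 2 + ζ 2 ^ 2 := by
  by_contra! hle
  apply h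
  ext i
  fin_cases i <;> simp <;> nlinarith [sq_nonneg (ζ 0), sq_nonneg (ζ 1), sq_nonneg (ζ 2)]

lemma nrm_pos {ζ : Fin 3 → ℝ} (h : ζ ≠ 0) : 0 < nrm ζ :=
  Real.sqrt_pos.2 (sum_sq_pos h)

lemma nrm_sq (ζ : Fin 3 → ℝ) : nrm ζ ^ 2 = ζ 0 ^ 2 + ζ 1 ^ 2 + ζ 2 ^ 2 :=
  Real.sq_sqrt (by positivity)

lemma differentiableAt_Lam {ζ : Fin 3 → ℝ} (h : ζ ≠ 0) : DifferentiableAt ℝ Lam ζ := by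
  have hs := (sum_sq_pos h).ne'
  have hn : DifferentiableAt ℝ nrm ζ := by
    unfold nrm
    exact DifferentiableAt.sqrt (by fun_prop) hs
  have hnum : DifferentiableAt ℝ (fun x : Fin 3 → ℝ => x 2) ζ := by fun_prop
  rw [show Lam = fun x => x 2 * (nrm x)⁻¹ from funext fun x => div_eq_mul_inv _ _]
  exact hnum.fun_mul (hn.fun_inv (nrm_pos h).ne')

lemma fderiv_Lam_apply {ζ : Fin 3 → ℝ} (h : ζ ≠ 0) (v : Fin 3 → ℝ) :
    fderiv ℝ Lam ζ v =
      (v 2 * nrm ζ ^ 2 - ζ 2 * (ζ 0 * v 0 + ζ 1 * v 1 + ζ 2 * v 2)) / nrm ζ ^ 3 := by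
  have hpos := nrm_pos h
  have hc (i : Fin 3) : HasDerivAt (fun t : ℝ => (ζ + t • v) i) (v i) 0 := by
    simpa using ((hasDerivAt_id (0 : ℝ)).mul_const (v i)).const_add (ζ i)
  have hn : HasDerivAt (fun t : ℝ => nrm (ζ + t • v))
      ((ζ 0 * v 0 + ζ 1 * v 1 + ζ 2 * v 2) / nrm ζ) 0 := by
    have hs := ((((hc 0).fun_pow 2).fun_add ((hc 1).fun_pow 2)).fun_add ((hc 2).fun_pow 2)).sqrt
      (by simpa using (sum_sq_pos h).ne')
    refine hs.congr_deriv ?_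
    have hz : √(ζ 0 ^ 2 + ζ 1 ^ 2 + ζ 2 ^ 2) = nrm ζ := rfl
    simp [hz]
    field_simp
  have hL := (hc 2).fun_div hn (by simpa using hpos.ne')
  have hline : HasLineDerivAt ℝ Lam _ ζ v := hL
  rw [← (differentiableAt_Lam h).lineDeriv_eq_fderiv, hline.lineDeriv]
  simp
  field_simp

/-- `S_η Φ(ξ,η) = σ̄(ξ,η) · (ξ_h − η_h) / ‖ξ−η‖³`, with
`σ̄(ξ,η) = ξ₃ η_h − η₃ ξ_h`. -/
theorem stmt2 (ν : ℝ) (hν : ν = 1 ∨ ν = -1) (ξ η : Fin 3 → ℝ)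
    (hξ : ξ ≠ 0) (hη : η ≠ 0) (hξη : ξ - η ≠ 0) :
    SV (Phi ν ξ) η =
      ((ξ 2 * η 0 - η 2 * ξ 0) * (ξ 0 - η 0) + (ξ 2 * η 1 - η 2 * ξ 1) * (ξ 1 - η 1)) /
        nrm (ξ - η) ^ 3 := by
  have hsub : HasFDerivAt (fun x => Lam (ξ - x))
      ((fderiv ℝ Lam (ξ - η)).comp (-ContinuousLinearMap.id ℝ (Fin 3 → ℝ))) η :=
    (differentiableAt_Lam hξη).hasFDerivAt.comp η ((hasFDerivAt_id η).const_sub ξ)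
  have hPhi : HasFDerivAt (Phi ν ξ) _ η :=
    (hsub.const_add (Lam ξ)).fun_add ((differentiableAt_Lam hη).hasFDerivAt.const_mul ν)
  have hpos := nrm_pos hξη
  have hS : SV (Phi ν ξ) η = -fderiv ℝ Lam (ξ - η) η + ν * fderiv ℝ Lam η η := by
    simp [SV, hPhi.fderiv]
  rw [hS, fderiv_Lam_apply hξη, fderiv_Lam_apply hη, nrm_sq, nrm_sq]
  simp only [Pi.sub_apply]
  field_simp
  ring
end

section
/- Let g : ℝ³∖{0} → ℂ be differentiable and axisymmetric, i.e. g(Rζ) = g(ζ) for every ζ ≠ 0 and every rotation R of ℝ³ about the x₃-axis. Let ξ, η ∈ ℝ³ with η ≠ 0, η_h ≠ 0, and set ζ = ξ − η, assuming ζ ≠ 0 and ζ_h ≠ 0. Define ω_c = (η_h·ζ_h)/(‖η_h‖‖ζ_h‖), ω_s = (η_h·ζ_h^⊥)/(‖η_h‖‖ζ_h‖), and the coefficients Γ_S^S = −(‖η‖/‖ζ‖)[ω_c(‖η_h‖/‖η‖)(‖ζ_h‖/‖ζ‖) + (ζ₃/‖ζ‖)(η₃/‖η‖)], Γ_S^Υ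 = −(‖η‖/‖ζ‖)[ω_c(‖η_h‖/‖η‖)(ζ₃/‖ζ‖) − (η₃/‖η‖)(‖ζ_h‖/‖ζ‖)], Γ_Ω^S = (‖η‖/‖ζ‖)·ω_s·(‖η_h‖/‖η‖)(‖ζ_h‖/‖ζ‖), Γ_Ω^Υ = (‖η‖/‖ζ‖)·ω_s·(‖η_h‖/‖η‖)(ζ₃/‖ζ‖). Then: (i) −η·(∇g)(ζ) = Γ_S^S·(Sg)(ζ) + Γ_S^Υ·(Υg)(ζ), and (ii) η₂(∂₁g)(ζ) − η₁(∂₂g)(ζ) = Γ_Ω^S·(Sg)(ζ) + Γ_Ω^Υ·(Υg)(ζ). -/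
/-- Rotation of `ℝ³` about the `x₃`-axis by the angle `θ`. -/
noncomputable def rotZ (θ : ℝ) (ζ : Fin 3 → ℝ) : Fin 3 → ℝ :=
  ![Real.cos θ * ζ 0 - Real.sin θ * ζ 1, Real.sin θ * ζ 0 + Real.cos θ * ζ 1, ζ 2]

theorem hasDerivAt_rotZ_zero (ζ : Fin 3 → ℝ) :
    HasDerivAt (fun θ => rotZ θ ζ) ![-ζ 1, ζ 0, 0] 0 := by
  have hc : HasDerivAt Real.cos 0 0 := by simpa using Real.hasDerivAt_cos 0
  have hs : HasDerivAt Real.sin 1 0 := by simpa using Real.hasDerivAt_sin 0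
  rw [hasDerivAt_pi]
  intro i
  fin_cases i
  · simpa [rotZ] using (hc.mul_const (ζ 0)).fun_sub (hs.mul_const (ζ 1))
  · simpa [rotZ] using (hs.mul_const (ζ 0)).fun_add (hc.mul_const (ζ 1))
  · simpa [rotZ] using hasDerivAt_const (0 : ℝ) (ζ 2)

theorem rotZ_zero (ζ : Fin 3 → ℝ) : rotZ 0 ζ = ζ := by
  ext i
  fin_cases i <;> simp [rotZ]

/-- The derivative of an axisymmetric function vanishes in the azimuthal direction. -/
theorem fderiv_azimuthal_eq_zero {g : (Fin 3 → ℝ) → ℂ} {ζ : Fin 3 → ℝ}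
    (hdiff : DifferentiableAt ℝ g ζ) (haxi : ∀ θ, g (rotZ θ ζ) = g ζ) :
    fderiv ℝ g ζ ![-ζ 1, ζ 0, 0] = 0 := by
  have hg : HasFDerivAt g (fderiv ℝ g ζ) (rotZ 0 ζ) := by
    rw [rotZ_zero]
    exact hdiff.hasFDerivAt
  have hd := hg.comp_hasDerivAt (0 : ℝ) (hasDerivAt_rotZ_zero ζ)
  have hconst : g ∘ (fun θ => rotZ θ ζ) = fun _ => g ζ := funext haxi
  rw [hconst] at hd
  exact hd.unique (hasDerivAt_const _ _)

theorem clm_apply_eq_sum_single (L : (Fin 3 → ℝ) →L[ℝ] ℂ) (v : Fin 3 → ℝ) :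
    L v = (v 0 : ℂ) * L (Pi.single 0 1) + (v 1 : ℂ) * L (Pi.single 1 1) +
      (v 2 : ℂ) * L (Pi.single 2 1) := by
  conv_lhs => rw [pi_eq_sum_univ' v]
  simp [Fin.sum_univ_three]

/-- Resolution of the vector fields `S_η`, `Ω_η` applied to `g(ξ−η)` in terms of
the scaling (`S`) and polar-angle (`Υ`) derivatives of the axisymmetric function
`g` at `ζ = ξ − η`. -/
theorem stmt9 (g : (Fin 3 → ℝ) → ℂ)
    (hdiff : ∀ ζ : Fin 3 → ℝ, ζ ≠ 0 → DifferentiableAt ℝ g ζ)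
    (haxi : ∀ (θ : ℝ) (ζ : Fin 3 → ℝ), g (rotZ θ ζ) = g ζ)
    (ξ η ζ : Fin 3 → ℝ) (hζdef : ζ = ξ - η)
    (hη : η ≠ 0) (hηh : ¬(η 0 = 0 ∧ η 1 = 0))
    (hζ : ζ ≠ 0) (hζh : ¬(ζ 0 = 0 ∧ ζ 1 = 0))
    (nEta nZeta nEtah nZetah wc ws GSS GSU GOS GOU : ℝ) (Sg Ug : ℂ)
    (hnEta : nEta = Real.sqrt (η 0 ^ 2 + η 1 ^ 2 + η 2 ^ 2))
    (hnZeta : nZeta = Real.sqrt (ζ 0 ^ 2 + ζ 1 ^ 2 + ζ 2 ^ 2))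
    (hnEtah : nEtah = Real.sqrt (η 0 ^ 2 + η 1 ^ 2))
    (hnZetah : nZetah = Real.sqrt (ζ 0 ^ 2 + ζ 1 ^ 2))
    (hwc : wc = (η 0 * ζ 0 + η 1 * ζ 1) / (nEtah * nZetah))
    (hws : ws = (-(η 0) * ζ 1 + η 1 * ζ 0) / (nEtah * nZetah))
    (hGSS : GSS = -(nEta / nZeta) *
        (wc * (nEtah / nEta) * (nZetah / nZeta) + (ζ 2 / nZeta) * (η 2 / nEta)))
    (hGSU : GSU = -(nEta / nZeta) *
        (wc * (nEtah / nEta) * (ζ 2 / nZeta) - (η 2 / nEta) * (nZetah / nZeta)))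
    (hGOS : GOS = (nEta / nZeta) * ws * (nEtah / nEta) * (nZetah / nZeta))
    (hGOU : GOU = (nEta / nZeta) * ws * (nEtah / nEta) * (ζ 2 / nZeta))
    (hSg : Sg = fderiv ℝ g ζ ζ)
    (hUg : Ug = ((ζ 2 / nZetah : ℝ) : ℂ) *
          ((ζ 0 : ℂ) * fderiv ℝ g ζ (Pi.single 0 1) + (ζ 1 : ℂ) * fderiv ℝ g ζ (Pi.single 1 1)) -
        (nZetah : ℂ) * fderiv ℝ g ζ (Pi.single 2 1)) :
    -(fderiv ℝ g ζ η) = (GSS : ℂ) * Sg + (GSU : ℂ) * Ug ∧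
    (η 1 : ℂ) * fderiv ℝ g ζ (Pi.single 0 1) - (η 0 : ℂ) * fderiv ℝ g ζ (Pi.single 1 1) =
      (GOS : ℂ) * Sg + (GOU : ℂ) * Ug := by
  have haz := fderiv_azimuthal_eq_zero (hdiff ζ hζ) (fun θ => haxi θ ζ)
  rw [clm_apply_eq_sum_single] at haz
  rw [clm_apply_eq_sum_single] at hSg
  rw [clm_apply_eq_sum_single]
  generalize fderiv ℝ g ζ (Pi.single 0 1) = a at *
  generalize fderiv ℝ g ζ (Pi.single 1 1) = b at *
  generalize fderiv ℝ g ζ (Pi.single 2 1) = c at *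
  have pos_of_ne (v : Fin 3 → ℝ) (hv : ¬(v 0 = 0 ∧ v 1 = 0)) : 0 < v 0 ^ 2 + v 1 ^ 2 := by
    rcases not_and_or.mp hv with h | h <;> positivity
  have hηp := pos_of_ne η hηh
  have hζp := pos_of_ne ζ hζh
  have hr : nZetah ≠ 0 := by rw [hnZetah]; positivity
  have hs : nEtah ≠ 0 := by rw [hnEtah]; positivity
  have hN : nZeta ≠ 0 := by rw [hnZeta]; positivity
  have hM : nEta ≠ 0 := by rw [hnEta]; positivity
  have hr2 : nZetah ^ 2 = ζ 0 ^ 2 + ζ 1 ^ 2 := by rw [hnZetah, Real.sq_sqrt hζp.le]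
  have hN2 : nZeta ^ 2 = nZetah ^ 2 + ζ 2 ^ 2 := by
    rw [hr2, hnZeta, Real.sq_sqrt (by positivity)]
  have hGSS' : GSS = -(η 0 * ζ 0 + η 1 * ζ 1 + ζ 2 * η 2) / nZeta ^ 2 := by
    rw [hGSS, hwc]; field_simp
  have hGSU' : GSU = -((η 0 * ζ 0 + η 1 * ζ 1) * ζ 2 / nZetah - η 2 * nZetah) / nZeta ^ 2 := by
    rw [hGSU, hwc]; field_simp
  have hGOS' : GOS = (η 1 * ζ 0 - η 0 * ζ 1) / nZeta ^ 2 := by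
    rw [hGOS, hws]; field_simp; ring
  have hGOU' : GOU = (η 1 * ζ 0 - η 0 * ζ 1) * ζ 2 / nZetah / nZeta ^ 2 := by
    rw [hGOU, hws]; field_simp; ring
  have hrC : (nZetah : ℂ) ≠ 0 := by exact_mod_cast hr
  have hNC : (nZeta : ℂ) ≠ 0 := by exact_mod_cast hN
  have hr2C : (nZetah : ℂ) ^ 2 = (ζ 0 : ℂ) ^ 2 + (ζ 1 : ℂ) ^ 2 := by exact_mod_cast hr2
  have hN2C : (nZeta : ℂ) ^ 2 = (nZetah : ℂ) ^ 2 + (ζ 2 : ℂ) ^ 2 := by exact_mod_cast hN2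
  have hazC : (ζ 0 : ℂ) * b = (ζ 1 : ℂ) * a := by
    simp only [Matrix.cons_val, Complex.ofReal_neg, Complex.ofReal_zero] at haz
    linear_combination haz
  obtain ⟨p, ha, hb⟩ : ∃ p : ℂ, a = ζ 0 * p ∧ b = ζ 1 * p := by
    refine ⟨(ζ 0 * a + ζ 1 * b) / nZetah ^ 2, ?_, ?_⟩
    · field_simp
      linear_combination a * hr2C - ζ 1 * hazC
    · field_simp
      linear_combination b * hr2C + ζ 0 * hazC
  have hSg' : Sg = nZetah ^ 2 * p + ζ 2 * c := by
    rw [hSg, ha, hb, hr2C]; ring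
  have hUg' : Ug = nZetah * (ζ 2 * p - c) := by
    rw [hUg, ha, hb]
    push_cast
    field_simp
    linear_combination -(ζ 2 * p) * hr2C
  rw [hGSS', hGSU', hGOS', hGOU', hSg', hUg', ha, hb]
  push_cast
  constructor
  · field_simp
    rw [hN2C]; ring
  · field_simp
    rw [hN2C]; ring
end

section
/- Let r ≥ 1, b ≥ 0, K ≥ 1 be integers. There exist constants C₁ = C₁(r,b) > 0 and C₂ = C₂(K,r,b) > 0 such that for every integer a ≥ 0 and every f ∈ C_c^∞(ℝ³;ℝ): (i) ‖S^{≤a+b}f‖_{L^{2r}} ≤ C₁ · ‖S^{≤a}f‖_{L^{2r}}^{1/2} · ‖S^{≤a+2b}f‖_{L^{2r}}^{1/2}, and (ii) ‖S^{≤b}f‖_{L^{2r}} ≤ C₂ · ‖f‖_{L^{2r}}^{1−1/K} · ‖S^{≤Kb}f‖_{L^{2r}}^{1/K}. The constants are uniform in a and in f. -/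
open MeasureTheory

/-- The scaling vector field `(Sf)(x) = x·∇f(x)`. -/
noncomputable def Sop (f : (Fin 3 → ℝ) → ℝ) : (Fin 3 → ℝ) → ℝ := fun x => fderiv ℝ f x x

/-- `‖S^{≤n}f‖_{L^{2r}} = max_{0≤α≤n} ‖S^α f‖_{L^{2r}}`. -/
noncomputable def SleNorm (r n : ℕ) (f : (Fin 3 → ℝ) → ℝ) : ℝ :=
  ⨆ α : Fin (n + 1), (eLpNorm (Sop^[(α : ℕ)] f) (2 * r) volume).toReal

/-- The three-factor Hölder inequality `∫ |u| |v|^m |w| ≤ ‖u‖_p ‖v‖_p^m ‖w‖_p` with `p = m + 2`. -/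
lemma lintegral_enorm_mul_pow_mul_le {α : Type*} [MeasurableSpace α] {μ : Measure α} (m : ℕ)
    {u v w : α → ℝ} (hu : AEStronglyMeasurable u μ) (hv : AEStronglyMeasurable v μ)
    (hw : AEStronglyMeasurable w μ) :
    ∫⁻ x, ‖u x * v x ^ m * w x‖ₑ ∂μ ≤
      eLpNorm u ((m + 2 : ℕ) : ENNReal) μ * eLpNorm v ((m + 2 : ℕ) : ENNReal) μ ^ m *
        eLpNorm w ((m + 2 : ℕ) : ENNReal) μ := by
  have hp : (0 : ℝ) < m + 2 := by positivity
  have hroot (t : ENNReal) : (t ^ ((m : ℝ) + 2)) ^ (1 / ((m : ℝ) + 2)) = t := by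
    rw [← ENNReal.rpow_mul, mul_one_div_cancel hp.ne', ENNReal.rpow_one]
  have hpow (t : ENNReal) : (t ^ ((m : ℝ) + 2)) ^ ((m : ℝ) / ((m : ℝ) + 2)) = t ^ m := by
    rw [← ENNReal.rpow_mul, mul_div_cancel₀ _ hp.ne', ENNReal.rpow_natCast]
  have key := ENNReal.lintegral_prod_norm_pow_le (μ := μ) Finset.univ
    (f := ![fun x => ‖u x‖ₑ ^ ((m : ℝ) + 2), fun x => ‖v x‖ₑ ^ ((m : ℝ) + 2),
      fun x => ‖w x‖ₑ ^ ((m : ℝ) + 2)])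
    (p := ![1 / ((m : ℝ) + 2), (m : ℝ) / ((m : ℝ) + 2), 1 / ((m : ℝ) + 2)])
    (by
      intro i _
      fin_cases i
      · exact hu.enorm.pow_const _
      · exact hv.enorm.pow_const _
      · exact hw.enorm.pow_const _)
    (by simp [Fin.sum_univ_three]; field_simp; ring)
    (by intro i _; fin_cases i <;> simp <;> positivity)
  simp only [Fin.prod_univ_three, Matrix.cons_val_zero, Matrix.cons_val_one, Matrix.cons_val,
    hroot, hpow] at key
  have hnorm (g : α → ℝ) : eLpNorm g ((m + 2 : ℕ) : ENNReal) μ =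
      (∫⁻ x, ‖g x‖ₑ ^ ((m : ℝ) + 2) ∂μ) ^ (1 / ((m : ℝ) + 2)) := by
    rw [eLpNorm_eq_lintegral_rpow_enorm_toReal (by simp) (by simp),
      ENNReal.toReal_natCast]
    push_cast
    rfl
  have hnorm' (g : α → ℝ) : eLpNorm g ((m + 2 : ℕ) : ENNReal) μ ^ m =
      (∫⁻ x, ‖g x‖ₑ ^ ((m : ℝ) + 2) ∂μ) ^ ((m : ℝ) / ((m : ℝ) + 2)) := by
    rw [hnorm, ← ENNReal.rpow_natCast, ← ENNReal.rpow_mul, one_div_mul_eq_div]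
  rw [hnorm', hnorm u, hnorm w]
  simpa only [enorm_mul, enorm_pow] using key

lemma abs_integral_mul_pow_mul_le {α : Type*} [MeasurableSpace α] {μ : Measure α} (m : ℕ)
    {u v w : α → ℝ} (hu : MemLp u ((m + 2 : ℕ) : ENNReal) μ)
    (hv : MemLp v ((m + 2 : ℕ) : ENNReal) μ) (hw : MemLp w ((m + 2 : ℕ) : ENNReal) μ) :
    |∫ x, u x * v x ^ m * w x ∂μ| ≤
      (eLpNorm u ((m + 2 : ℕ) : ENNReal) μ).toReal *
        (eLpNorm v ((m + 2 : ℕ) : ENNReal) μ).toReal ^ m *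
        (eLpNorm w ((m + 2 : ℕ) : ENNReal) μ).toReal := by
  have h := (enorm_integral_le_lintegral_enorm (μ := μ) fun x => u x * v x ^ m * w x).trans
    (lintegral_enorm_mul_pow_mul_le m hu.1 hv.1 hw.1)
  have h' := ENNReal.toReal_mono (ENNReal.mul_ne_top
    (ENNReal.mul_ne_top hu.eLpNorm_ne_top (ENNReal.pow_ne_top hv.eLpNorm_ne_top))
    hw.eLpNorm_ne_top) h
  simpa only [ENNReal.toReal_mul, ENNReal.toReal_pow, toReal_enorm, Real.norm_eq_abs] using h'

lemma integral_pow_eq_toReal_eLpNorm_pow {α : Type*} [MeasurableSpace α] {μ : Measure α} {m : ℕ}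
    (hm : Even m) {v : α → ℝ} (hv : MemLp v ((m + 2 : ℕ) : ENNReal) μ) :
    ∫ x, v x ^ (m + 2) ∂μ = (eLpNorm v ((m + 2 : ℕ) : ENNReal) μ).toReal ^ (m + 2) := by
  have hnn : 0 ≤ ∫ x, |v x| ^ (m + 2) ∂μ := integral_nonneg fun x => by positivity
  have heven (x : α) : |v x| ^ (m + 2) = v x ^ (m + 2) := (hm.add even_two).pow_abs _
  rw [hv.eLpNorm_eq_integral_rpow_norm (by simp) (by simp)]
  simp only [ENNReal.toReal_natCast, Real.rpow_natCast, Real.norm_eq_abs]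
  rw [ENNReal.toReal_ofReal (by positivity), Real.rpow_inv_natCast_pow hnn (by omega)]
  simp only [heven]

lemma contDiff_Sop {f : (Fin 3 → ℝ) → ℝ} (hf : ContDiff ℝ (⊤ : ℕ∞) f) :
    ContDiff ℝ (⊤ : ℕ∞) (Sop f) :=
  (hf.fderiv_right (m := (⊤ : ℕ∞)) (by simp)).clm_apply contDiff_id

lemma hasCompactSupport_Sop {f : (Fin 3 → ℝ) → ℝ} (hf : HasCompactSupport f) :
    HasCompactSupport (Sop f) := by
  refine (hf.fderiv (𝕜 := ℝ)).mono fun x hx h => hx ?_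
  simp [Sop, h]

lemma contDiff_Sop_iterate {f : (Fin 3 → ℝ) → ℝ} (hf : ContDiff ℝ (⊤ : ℕ∞) f) (n : ℕ) :
    ContDiff ℝ (⊤ : ℕ∞) (Sop^[n] f) := by
  induction n with
  | zero => exact hf
  | succ n ih => rw [Function.iterate_succ_apply']; exact contDiff_Sop ih

lemma hasCompactSupport_Sop_iterate {f : (Fin 3 → ℝ) → ℝ} (hf : HasCompactSupport f) (n : ℕ) :
    HasCompactSupport (Sop^[n] f) := by
  induction n with
  | zero => exact hf
  | succ n ih => rw [Function.iterate_succ_apply']; exact hasCompactSupport_Sop ih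

/-- Since `x` has divergence `3`, `∫ Sh = -3 ∫ h`. -/
lemma integral_Sop {h : (Fin 3 → ℝ) → ℝ} (hh : ContDiff ℝ (⊤ : ℕ∞) h) (hc : HasCompactSupport h) :
    ∫ x, Sop h x = -3 * ∫ x, h x := by
  have hcont (v : Fin 3 → ℝ) : Continuous fun x => fderiv ℝ h x v :=
    (hh.continuous_fderiv (by simp)).clm_apply continuous_const
  have hint (i : Fin 3) : Integrable fun x : Fin 3 → ℝ => x i * fderiv ℝ h x (Pi.single i 1) :=
    ((continuous_apply i).mul (hcont _)).integrable_of_hasCompactSupport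
      (hc.fderiv_apply (𝕜 := ℝ) _).mul_left
  have hd (i : Fin 3) (x : Fin 3 → ℝ) :
      fderiv ℝ (fun y : Fin 3 → ℝ => y i) x (Pi.single i 1) = 1 := by
    rw [(hasFDerivAt_apply (𝕜 := ℝ) i x).fderiv]
    simp
  have hpart (i : Fin 3) : ∫ x : Fin 3 → ℝ, x i * fderiv ℝ h x (Pi.single i 1) = -∫ x, h x := by
    have := integral_mul_fderiv_eq_neg_fderiv_mul_of_integrable (μ := volume)
      (f := fun y : Fin 3 → ℝ => y i) (g := h) (v := Pi.single i 1)
      (by simpa only [hd, one_mul] using hh.continuous.integrable_of_hasCompactSupport hc)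
      (hint i)
      (((continuous_apply i).mul hh.continuous).integrable_of_hasCompactSupport hc.mul_left)
      (fun x _ => (hasFDerivAt_apply (𝕜 := ℝ) i x).differentiableAt)
      (fun x _ => hh.differentiable (by simp) x)
    simpa only [hd, one_mul] using this
  have hsum (x : Fin 3 → ℝ) : Sop h x = ∑ i, x i * fderiv ℝ h x (Pi.single i 1) := by
    rw [Sop]
    conv_lhs => enter [2]; rw [pi_eq_sum_univ' x]
    simp [map_sum, map_smul]
  simp only [hsum]
  rw [integral_finsetSum _ fun i _ => hint i]
  simp [hpart]

lemma Sop_mul_pow {g v : (Fin 3 → ℝ) → ℝ} (hg : Differentiable ℝ g) (hv : Differentiable ℝ v)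
    (n : ℕ) (x : Fin 3 → ℝ) :
    Sop (fun y => g y * v y ^ (n + 1)) x =
      Sop g x * v x ^ (n + 1) + (n + 1) * (g x * v x ^ n * Sop v x) := by
  have := ((hg x).hasFDerivAt.mul ((hv x).hasFDerivAt.pow (n + 1))).fderiv
  simp only [Sop]
  refine (congrArg (fun T => T x) this).trans ?_
  simp
  ring

lemma sq_eLpNorm_Sop_le {m : ℕ} (hm : Even m) {g : (Fin 3 → ℝ) → ℝ}
    (hg : ContDiff ℝ (⊤ : ℕ∞) g) (hc : HasCompactSupport g) :
    (eLpNorm (Sop g) ((m + 2 : ℕ) : ENNReal) volume).toReal ^ 2 ≤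
      (eLpNorm g ((m + 2 : ℕ) : ENNReal) volume).toReal *
        (3 * (eLpNorm (Sop g) ((m + 2 : ℕ) : ENNReal) volume).toReal +
          (m + 1) * (eLpNorm (Sop (Sop g)) ((m + 2 : ℕ) : ENNReal) volume).toReal) := by
  have hv := contDiff_Sop hg
  have hvc := hasCompactSupport_Sop hc
  have hw := contDiff_Sop hv
  have hwc := hasCompactSupport_Sop hvc
  have mg : MemLp g ((m + 2 : ℕ) : ENNReal) volume := hg.continuous.memLp_of_hasCompactSupport hc
  have mv : MemLp (Sop g) ((m + 2 : ℕ) : ENNReal) volume :=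
    hv.continuous.memLp_of_hasCompactSupport hvc
  have mw : MemLp (Sop (Sop g)) ((m + 2 : ℕ) : ENNReal) volume :=
    hw.continuous.memLp_of_hasCompactSupport hwc
  have hI := integral_Sop (h := fun y => g y * Sop g y ^ (m + 1)) (hg.mul (hv.pow _)) hc.mul_right
  have hS (x : Fin 3 → ℝ) : Sop (fun y => g y * Sop g y ^ (m + 1)) x =
      Sop g x ^ (m + 2) + (m + 1) * (g x * Sop g x ^ m * Sop (Sop g) x) := by
    rw [Sop_mul_pow (hg.differentiable (by simp)) (hv.differentiable (by simp))]
    ring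
  have i1 : Integrable fun x => Sop g x ^ (m + 2) :=
    (hv.continuous.pow _).integrable_of_hasCompactSupport
      (hvc.comp_left (g := fun t : ℝ => t ^ (m + 2)) (by simp))
  have i2 : Integrable fun x => g x * Sop g x ^ m * Sop (Sop g) x :=
    ((hg.continuous.mul (hv.continuous.pow _)).mul hw.continuous).integrable_of_hasCompactSupport
      hwc.mul_left
  have hsplit : (fun y => g y * Sop g y ^ (m + 1)) = fun y => g y * Sop g y ^ m * Sop g y := by
    funext y; ring
  simp only [hS] at hI
  rw [integral_add i1 (i2.const_mul _), integral_const_mul,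
    integral_pow_eq_toReal_eLpNorm_pow hm mv, hsplit] at hI
  have b1 := abs_le.1 (abs_integral_mul_pow_mul_le m mg mv mv)
  have b2 := abs_le.1 (abs_integral_mul_pow_mul_le m mg mv mw)
  set A := (eLpNorm g ((m + 2 : ℕ) : ENNReal) volume).toReal
  set B := (eLpNorm (Sop g) ((m + 2 : ℕ) : ENNReal) volume).toReal
  set D := (eLpNorm (Sop (Sop g)) ((m + 2 : ℕ) : ENNReal) volume).toReal
  have hA0 : 0 ≤ A := ENNReal.toReal_nonneg
  have hD0 : 0 ≤ D := ENNReal.toReal_nonneg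
  have hB0 : 0 ≤ B := ENNReal.toReal_nonneg
  rcases hB0.eq_or_lt with h0 | h0
  · rw [← h0, zero_pow two_ne_zero]
    positivity
  · refine le_of_mul_le_mul_left ?_ (pow_pos h0 m)
    have b2' := mul_le_mul_of_nonneg_left b2.1 (by positivity : (0 : ℝ) ≤ m + 1)
    calc B ^ m * B ^ 2 = B ^ (m + 2) := by ring
      _ ≤ 3 * (A * B ^ m * B) + (m + 1) * (A * B ^ m * D) := by linarith [b1.1]
      _ = B ^ m * (A * (3 * B + (m + 1) * D)) := by ring

lemma le_SleNorm (r : ℕ) {k n : ℕ} (h : k ≤ n) (f : (Fin 3 → ℝ) → ℝ) :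
    (eLpNorm (Sop^[k] f) (2 * r) volume).toReal ≤ SleNorm r n f :=
  le_ciSup (f := fun α : Fin (n + 1) => (eLpNorm (Sop^[(α : ℕ)] f) (2 * r) volume).toReal)
    (Set.finite_range _).bddAbove ⟨k, Nat.lt_succ_of_le h⟩

lemma SleNorm_nonneg (r n : ℕ) (f : (Fin 3 → ℝ) → ℝ) : 0 ≤ SleNorm r n f :=
  ENNReal.toReal_nonneg.trans (le_SleNorm r n.zero_le f)

lemma SleNorm_monotone (r : ℕ) (f : (Fin 3 → ℝ) → ℝ) : Monotone fun n => SleNorm r n f :=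
  fun _ _ hmn => ciSup_le fun α => le_SleNorm r ((Nat.lt_succ_iff.1 α.2).trans hmn) f

lemma sq_SleNorm_succ_le {r : ℕ} (hr : 1 ≤ r) {f : (Fin 3 → ℝ) → ℝ}
    (hf : ContDiff ℝ (⊤ : ℕ∞) f) (hc : HasCompactSupport f) (n : ℕ) :
    SleNorm r (n + 1) f ^ 2 ≤ (2 * r + 2) * (SleNorm r n f * SleNorm r (n + 2) f) := by
  have h0 := SleNorm_nonneg r n f
  have h2 := SleNorm_nonneg r (n + 2) f
  obtain ⟨⟨k, hk⟩, hmax⟩ := exists_eq_ciSup_of_finite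
    (f := fun α : Fin (n + 1 + 1) => (eLpNorm (Sop^[(α : ℕ)] f) (2 * r) volume).toReal)
  change (eLpNorm (Sop^[k] f) (2 * r) volume).toReal = SleNorm r (n + 1) f at hmax
  rcases Nat.lt_succ_iff_lt_or_eq.1 hk with hk | rfl
  · have h01 : SleNorm r (n + 1) f ≤ SleNorm r n f :=
      hmax ▸ le_SleNorm r (Nat.lt_succ_iff.1 hk) f
    have h12 : SleNorm r (n + 1) f ≤ SleNorm r (n + 2) f := SleNorm_monotone r f (Nat.le_succ _)
    have := mul_le_mul h01 h12 (SleNorm_nonneg r _ f) h0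
    have hr0 : (0 : ℝ) ≤ r := Nat.cast_nonneg r
    nlinarith [mul_nonneg h0 h2, mul_nonneg hr0 (mul_nonneg h0 h2)]
  · obtain ⟨q, rfl⟩ : ∃ q, r = q + 1 := ⟨r - 1, by omega⟩
    have hp : (2 * ((q + 1 : ℕ) : ENNReal)) = ((2 * q + 2 : ℕ) : ENNReal) := by push_cast; ring
    have key := sq_eLpNorm_Sop_le (m := 2 * q) (even_two_mul q) (contDiff_Sop_iterate hf n)
      (hasCompactSupport_Sop_iterate hc n)
    rw [← Function.iterate_succ_apply' Sop, ← Function.iterate_succ_apply' Sop, ← hp] at key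
    rw [← hmax]
    refine key.trans ?_
    have e0 := le_SleNorm (q + 1) le_rfl f (k := n)
    have e1 := le_SleNorm (q + 1) (Nat.le_succ (n + 1)) f
    have e2 := le_SleNorm (q + 1) le_rfl f (k := n + 2)
    calc _ ≤ SleNorm (q + 1) n f * (3 * SleNorm (q + 1) (n + 2) f +
          (((2 * q : ℕ) : ℝ) + 1) * SleNorm (q + 1) (n + 2) f) := by gcongr
      _ = _ := by push_cast; ring

/-- Increments of a discretely convex sequence, compared with the slopes at the end points. -/
lemma mul_slope_le_sub_le_mul_slope {L : ℕ → ℝ} (hL : Monotone fun n => L (n + 1) - L n)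
    (a k : ℕ) :
    k * (L (a + 1) - L a) ≤ L (a + k) - L a ∧
      L (a + k) - L a ≤ k * (L (a + k + 1) - L (a + k)) := by
  induction k with
  | zero => simp
  | succ k ih =>
    have h1 : L (a + 1) - L a ≤ L (a + k + 1) - L (a + k) := hL (Nat.le_add_right a k)
    have h2 : L (a + k + 1) - L (a + k) ≤ L (a + k + 1 + 1) - L (a + k + 1) :=
      hL (Nat.le_succ (a + k))
    have h3 := mul_le_mul_of_nonneg_left h2 (Nat.cast_nonneg (α := ℝ) k)
    rw [← add_assoc]
    push_cast
    constructor <;> linarith [ih.1, ih.2]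

lemma mul_le_of_monotone_sub {L : ℕ → ℝ} (hL : Monotone fun n => L (n + 1) - L n)
    (b : ℕ) {K : ℕ} (hK : 1 ≤ K) : K * L b ≤ (K - 1) * L 0 + L (K * b) := by
  obtain ⟨k, rfl⟩ : ∃ k, K = k + 1 := ⟨K - 1, by omega⟩
  have h1 := (mul_slope_le_sub_le_mul_slope hL 0 b).2
  have h2 := (mul_slope_le_sub_le_mul_slope hL b (k * b)).1
  rw [zero_add] at h1
  rw [show (k + 1) * b = b + k * b by ring]
  have h3 := mul_le_mul_of_nonneg_left h1 (Nat.cast_nonneg (α := ℝ) k)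
  push_cast at h2 ⊢
  linarith

/-- A monotone sequence that is log-convex up to a constant factor satisfies the interpolation
inequality between `0` and `K * b`. -/
lemma interpolation_of_sq_le {N : ℕ → ℝ} {C : ℝ} (hC : 0 < C) (h0 : ∀ n, 0 ≤ N n)
    (hN : Monotone N) (h : ∀ n, N (n + 1) ^ 2 ≤ C * (N n * N (n + 2))) (b : ℕ) {K : ℕ}
    (hK : 1 ≤ K) :
    N b ≤ Real.exp (Real.log C / 2 * ((K - 1) * b ^ 2)) * N 0 ^ (1 - (1 : ℝ) / K) *
      N (K * b) ^ ((1 : ℝ) / K) := by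
  have hK0 : (0 : ℝ) < K := by exact_mod_cast hK
  rcases (h0 0).eq_or_lt with hz | hpos
  · have hzero (n : ℕ) : N n = 0 := by
      induction n with
      | zero => exact hz.symm
      | succ n ih =>
        have := h n
        rw [ih, zero_mul, mul_zero] at this
        exact sq_nonpos_iff _ |>.1 this
    rw [hzero b]
    have := h0 0
    have := h0 (K * b)
    positivity
  · have hp (n : ℕ) : 0 < N n := hpos.trans_le (hN n.zero_le)
    have hL : Monotone fun n : ℕ =>
        (Real.log (N (n + 1)) + Real.log C / 2 * ((n + 1 : ℕ) : ℝ) ^ 2) -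
          (Real.log (N n) + Real.log C / 2 * (n : ℝ) ^ 2) := by
      refine monotone_nat_of_le_succ fun n => ?_
      have hl := Real.log_le_log (pow_pos (hp (n + 1)) 2) (h n)
      rw [Real.log_pow, Real.log_mul hC.ne' (mul_pos (hp _) (hp _)).ne',
        Real.log_mul (hp _).ne' (hp _).ne'] at hl
      push_cast at hl ⊢
      rw [show n + 1 + 1 = n + 2 from rfl]
      linarith
    have hmain := mul_le_of_monotone_sub
      (L := fun n => Real.log (N n) + Real.log C / 2 * (n : ℝ) ^ 2) hL b hK
    have hlog : Real.log (N b) ≤ Real.log C / 2 * ((K - 1) * b ^ 2) +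
        Real.log (N 0) * (1 - 1 / K) + Real.log (N (K * b)) * (1 / K) := by
      refine le_of_mul_le_mul_left ?_ hK0
      have e : (K : ℝ) * (Real.log C / 2 * ((K - 1) * b ^ 2) +
          Real.log (N 0) * (1 - 1 / K) + Real.log (N (K * b)) * (1 / K)) =
          K * (Real.log C / 2 * ((K - 1) * b ^ 2)) + Real.log (N 0) * (K - 1) +
            Real.log (N (K * b)) := by
        field_simp
      rw [e]
      push_cast at hmain
      linarith
    rw [Real.rpow_def_of_pos (hp 0), Real.rpow_def_of_pos (hp (K * b)), ← Real.exp_add,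
      ← Real.exp_add]
    exact (Real.log_le_iff_le_exp (hp b)).1 hlog

/-- Interpolation estimates for iterates of the scaling vector field, uniformly
in `a` and `f`. -/
theorem stmt15 (r b K : ℕ) (hr : 1 ≤ r) (hK : 1 ≤ K) :
    ∃ C₁ : ℝ, 0 < C₁ ∧ ∃ C₂ : ℝ, 0 < C₂ ∧
      ∀ (a : ℕ) (f : (Fin 3 → ℝ) → ℝ), ContDiff ℝ (⊤ : ℕ∞) f → HasCompactSupport f →
        SleNorm r (a + b) f ≤
            C₁ * SleNorm r a f ^ ((1 : ℝ) / 2) * SleNorm r (a + 2 * b) f ^ ((1 : ℝ) / 2) ∧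
        SleNorm r b f ≤
            C₂ * SleNorm r 0 f ^ (1 - (1 : ℝ) / K) * SleNorm r (K * b) f ^ ((1 : ℝ) / K) := by
  have hC : (0 : ℝ) < 2 * r + 2 := by positivity
  refine ⟨_, Real.exp_pos (Real.log (2 * r + 2) / 2 * (((2 : ℕ) - 1) * b ^ 2)), _,
    Real.exp_pos (Real.log (2 * r + 2) / 2 * ((K - 1) * b ^ 2)), fun a f hf hc => ⟨?_, ?_⟩⟩
  · have := interpolation_of_sq_le (N := fun n => SleNorm r (a + n) f) hC
      (fun n => SleNorm_nonneg r _ f)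
      (fun m n hmn => SleNorm_monotone r f (Nat.add_le_add_left hmn a))
      (fun n => sq_SleNorm_succ_le hr hf hc (a + n)) b (K := 2) one_le_two
    have e : (1 : ℝ) - 1 / (2 : ℕ) = 1 / 2 := by norm_num
    rw [e] at this
    exact_mod_cast this
  · exact interpolation_of_sq_le hC (fun n => SleNorm_nonneg r n f) (SleNorm_monotone r f)
      (sq_SleNorm_succ_le hr hf hc) b hK
end
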